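/- For every real x with 0 ≤ x < 1, one has -log(1-x) ≤ S(x) ≤ -log(1-x)/(1-x) ≤ x/(1-x)². -/

import Mathlib

/-- Lemma 2.2, bound on S: For real `0 ≤ x < 1`, with
`S(x) = ∑_{k=1}^∞ (1/k) x^k/(1-x^k)`, one has
`-log(1-x) ≤ S(x) ≤ -log(1-x)/(1-x) ≤ x/(1-x)²`. -/
theorem stmt2 (x : ℝ) (hx0 : 0 ≤ x) (hx1 : x < 1) :
    -Real.log (1 - x) ≤
      (∑' k : ℕ, 1 / ((k : ℝ) + 1) * (x ^ (k + 1) / (1 - x ^ (k + 1)))) ∧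
    (∑' k : ℕ, 1 / ((k : ℝ) + 1) * (x ^ (k + 1) / (1 - x ^ (k + 1)))) ≤
      -Real.log (1 - x) / (1 - x) ∧
    -Real.log (1 - x) / (1 - x) ≤ x / (1 - x) ^ 2 := by
  have h_pos : 0 < 1 - x := by linarith
  have h_log : HasSum (fun k : ℕ => x ^ (k + 1) / ((k : ℝ) + 1)) (-Real.log (1 - x)) :=
    Real.hasSum_pow_div_log_of_abs_lt_one (by rwa [abs_of_nonneg hx0])
  have h_lower (k : ℕ) : x ^ (k + 1) / ((k : ℝ) + 1) ≤
      1 / ((k : ℝ) + 1) * (x ^ (k + 1) / (1 - x ^ (k + 1))) := by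
    have h_lt : x ^ (k + 1) < 1 := pow_lt_one₀ hx0 hx1 k.succ_ne_zero
    have h_nonneg : 0 ≤ x ^ (k + 1) := by positivity
    rw [← one_div_mul_eq_div]
    gcongr
    exact le_div_self h_nonneg (by linarith) (by linarith)
  have h_upper (k : ℕ) : 1 / ((k : ℝ) + 1) * (x ^ (k + 1) / (1 - x ^ (k + 1))) ≤
      x ^ (k + 1) / ((k : ℝ) + 1) / (1 - x) := by
    have h_le : x ^ (k + 1) ≤ x := pow_le_of_le_one hx0 hx1.le k.succ_ne_zero
    rw [← one_div_mul_eq_div ((k : ℝ) + 1) (x ^ (k + 1)), mul_div_assoc]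
    gcongr
  have h_summable :
      Summable fun k : ℕ => 1 / ((k : ℝ) + 1) * (x ^ (k + 1) / (1 - x ^ (k + 1))) :=
    (h_log.div_const (1 - x)).summable.of_nonneg_of_le
      (fun k => le_trans (by positivity) (h_lower k)) h_upper
  refine ⟨hasSum_le h_lower h_log h_summable.hasSum,
    hasSum_le h_upper h_summable.hasSum (h_log.div_const (1 - x)), ?_⟩
  have h_bound : -Real.log (1 - x) ≤ x / (1 - x) := by
    have h_inv := Real.one_sub_inv_le_log_of_pos h_pos
    have h_eq : x / (1 - x) = (1 - x)⁻¹ - 1 := by field_simp; ring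
    linarith
  rw [sq, ← div_div]
  gcongr
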